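/- Let m be a positive integer and q ∈ (1, m+1]. Then q ∈ B_2(m) if and only if 1 ∈ U_q − U_q, i.e. there exist x, y ∈ U_q with x − y = 1. -/

import Mathlib

/-- A sequence of digits has a last nonzero digit. -/
def hasLastNonzero (c : ℕ → ℕ) : Prop := ∃ n, c n ≠ 0 ∧ ∀ i > n, c i = 0

/-- `c` (with `c i` the `(i+1)`-st digit) is a `q`-expansion of `x`
with respect to the digit set `Ω_m = {0,1,…,m}`. -/
def isExpansion (m : ℕ) (q : ℝ) (x : ℝ) (c : ℕ → ℕ) : Prop :=
  (∀ i, c i ≤ m) ∧ x = ∑' i : ℕ, (c i : ℝ) / q ^ (i + 1)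

/-- The set `U_q` of points of `I_q = [0, m/(q-1)]` with a unique `q`-expansion. -/
def Uq (m : ℕ) (q : ℝ) : Set ℝ :=
  {x | x ∈ Set.Icc 0 ((m : ℝ) / (q - 1)) ∧ ∃! c, isExpansion m q x c}

/-- The set `U'_q` of digit sequences that are unique `q`-expansions. -/
def Uq' (m : ℕ) (q : ℝ) : Set (ℕ → ℕ) :=
  {c | isExpansion m q (∑' i : ℕ, (c i : ℝ) / q ^ (i + 1)) c ∧
       ∀ d, isExpansion m q (∑' i : ℕ, (c i : ℝ) / q ^ (i + 1)) d → d = c}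

/-- `B_2(m)`: bases `q ∈ (1, m+1]` for which some `x ∈ I_q` has exactly two
different `q`-expansions. -/
def B2 (m : ℕ) : Set ℝ :=
  {q | q ∈ Set.Ioc 1 ((m : ℝ) + 1) ∧
    ∃ x ∈ Set.Icc (0 : ℝ) ((m : ℝ) / (q - 1)), ∃ a b : ℕ → ℕ,
      a ≠ b ∧ isExpansion m q x a ∧ isExpansion m q x b ∧
      ∀ c, isExpansion m q x c → c = a ∨ c = b}

/-- Strict lexicographic order on digit sequences. -/
def lexLt (a b : ℕ → ℕ) : Prop := ∃ n, (∀ i < n, a i = b i) ∧ a n < b n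

/-- Lexicographic order on digit sequences. -/
def lexLe (a b : ℕ → ℕ) : Prop := lexLt a b ∨ a = b

/-- `a` is the quasi-greedy `q`-expansion of `1`: the lexicographically largest
`q`-expansion of `1` without a last nonzero digit. -/
def isQuasiGreedy (m : ℕ) (q : ℝ) (a : ℕ → ℕ) : Prop :=
  isExpansion m q 1 a ∧ ¬ hasLastNonzero a ∧
  ∀ b, isExpansion m q 1 b → ¬ hasLastNonzero b → lexLe b a

/-- `A'_q = {(c_i) ∈ U'_q : c_1 < α_1(q)}`. -/
def Aq' (m : ℕ) (q : ℝ) : Set (ℕ → ℕ) :=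
  {c | c ∈ Uq' m q ∧ ∀ a, isQuasiGreedy m q a → c 0 < a 0}

/-- `f_{c,d}(t) = (m+1)/t + Σ_{i≥1} (c_i + d_i) t^{-(i+1)} - m/(t-1)`. -/
noncomputable def fcd (m : ℕ) (c d : ℕ → ℕ) (t : ℝ) : ℝ :=
  ((m : ℝ) + 1) / t + (∑' i : ℕ, ((c i : ℝ) + (d i : ℝ)) / t ^ (i + 2)) - (m : ℝ) / (t - 1)

/-- `x = q_f(m)`: the largest real root of `q³-(k+2)q²+q-(k+1)=0` if `m = 2k+1`,
and of `q²-(k+1)q-k=0` if `m = 2k`. -/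
def isQf (m : ℕ) (x : ℝ) : Prop :=
  (∃ k : ℕ, m = 2 * k + 1 ∧
    x ^ 3 - ((k : ℝ) + 2) * x ^ 2 + x - ((k : ℝ) + 1) = 0 ∧
    ∀ y : ℝ, y ^ 3 - ((k : ℝ) + 2) * y ^ 2 + y - ((k : ℝ) + 1) = 0 → y ≤ x) ∨
  (∃ k : ℕ, m = 2 * k ∧
    x ^ 2 - ((k : ℝ) + 1) * x - (k : ℝ) = 0 ∧
    ∀ y : ℝ, y ^ 2 - ((k : ℝ) + 1) * y - (k : ℝ) = 0 → y ≤ x)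

/-- A doubly infinite sequence: neither it nor its reflection has a last nonzero digit. -/
def doublyInfinite (m : ℕ) (c : ℕ → ℕ) : Prop :=
  ¬ hasLastNonzero c ∧ ¬ hasLastNonzero (fun i => m - c i)

/-- `V_q`: points of `I_q` with at most one doubly infinite `q`-expansion. -/
def Vq (m : ℕ) (q : ℝ) : Set ℝ :=
  {x | x ∈ Set.Icc 0 ((m : ℝ) / (q - 1)) ∧
    ∀ a b : ℕ → ℕ, isExpansion m q x a → isExpansion m q x b →
      doublyInfinite m a → doublyInfinite m b → a = b}

/-- `U = {q ∈ (1, m+1] : 1 ∈ U_q}`. -/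
def Uset (m : ℕ) : Set ℝ := {q | q ∈ Set.Ioc 1 ((m : ℝ) + 1) ∧ (1 : ℝ) ∈ Uq m q}

/-- `V = {q ∈ (1, m+1] : 1 ∈ V_q}`. -/
def Vset (m : ℕ) : Set ℝ := {q | q ∈ Set.Ioc 1 ((m : ℝ) + 1) ∧ (1 : ℝ) ∈ Vq m q}

/-- The generalized golden ratio `G(m)`. -/
noncomputable def Gratio (m : ℕ) : ℝ :=
  if m % 2 = 0 then ((m / 2 : ℕ) : ℝ) + 1
  else (((m / 2 : ℕ) : ℝ) + 1 +
    Real.sqrt (((m / 2 : ℕ) : ℝ) ^ 2 + 6 * ((m / 2 : ℕ) : ℝ) + 5)) / 2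

/-- The set of accumulation points of a set of reals. -/
def accPts (S : Set ℝ) : Set ℝ := {x | AccPt x (Filter.principal S)}

/-- Iterated accumulation-point sets `B_2^{(i)}(m)`. -/
def B2iter (m : ℕ) : ℕ → Set ℝ
  | 0 => B2 m
  | n + 1 => accPts (B2iter m n)

/-- The digit sequence `d` followed by `c`. -/
def consDigit (d : ℕ) (c : ℕ → ℕ) : ℕ → ℕ
  | 0 => d
  | n + 1 => c n

theorem summable_digits {m : ℕ} {q : ℝ} (hq : 1 < q) {c : ℕ → ℕ} (hc : ∀ i, c i ≤ m) :
    Summable fun i : ℕ => (c i : ℝ) / q ^ (i + 1) := by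
  have hq0 : 0 < q := by linarith
  have hgeo : Summable fun i : ℕ => (m : ℝ) * (1 / q) ^ i :=
    (summable_geometric_of_lt_one (by positivity) ((div_lt_one hq0).2 hq)).mul_left _
  refine Summable.of_nonneg_of_le (fun i => by positivity) (fun i => ?_) hgeo
  have hci : (c i : ℝ) ≤ m := by exact_mod_cast hc i
  rw [one_div, inv_pow, ← div_eq_mul_inv]
  exact div_le_div₀ (by positivity) hci (by positivity)
    (pow_le_pow_right₀ hq.le (Nat.le_succ i))

theorem hasSum_digits_const (m : ℕ) {q : ℝ} (hq : 1 < q) :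
    HasSum (fun i : ℕ => (m : ℝ) / q ^ (i + 1)) ((m : ℝ) / (q - 1)) := by
  have hq0 : 0 < q := by linarith
  have hq1 : q - 1 ≠ 0 := by linarith
  have h := (hasSum_geometric_of_lt_one (r := 1 / q) (by positivity)
    ((div_lt_one hq0).2 hq)).mul_left ((m : ℝ) / q)
  have hterm : ∀ i : ℕ, (m : ℝ) / q * (1 / q) ^ i = (m : ℝ) / q ^ (i + 1) := fun i => by
    rw [one_div, inv_pow, pow_succ]
    field_simp
  have hval : (m : ℝ) / q * (1 - 1 / q)⁻¹ = (m : ℝ) / (q - 1) := by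
    rw [one_sub_div hq0.ne', inv_div]
    field_simp
  simpa only [hterm, hval] using h

theorem isExpansion_mem_Icc {m : ℕ} {q x : ℝ} (hq : 1 < q) {c : ℕ → ℕ}
    (h : isExpansion m q x c) : x ∈ Set.Icc 0 ((m : ℝ) / (q - 1)) := by
  have hq0 : 0 < q := by linarith
  rw [h.2]
  refine ⟨tsum_nonneg fun i => by positivity, ?_⟩
  rw [← (hasSum_digits_const m hq).tsum_eq]
  refine (summable_digits hq h.1).tsum_le_tsum (fun i => ?_) (hasSum_digits_const m hq).summable
  have hci : (c i : ℝ) ≤ m := by exact_mod_cast h.1 i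
  gcongr

theorem tsum_digits_eq {m : ℕ} {q : ℝ} (hq : 1 < q) {c : ℕ → ℕ} (hc : ∀ i, c i ≤ m) :
    q * ∑' i : ℕ, (c i : ℝ) / q ^ (i + 1) = c 0 + ∑' i : ℕ, (c (i + 1) : ℝ) / q ^ (i + 1) := by
  have hq0 : 0 < q := by linarith
  rw [(summable_digits hq hc).tsum_eq_zero_add, mul_add, ← tsum_mul_left]
  congr 1
  · rw [zero_add, pow_one]
    field_simp
  · refine tsum_congr fun i => ?_
    rw [pow_succ q (i + 1)]
    field_simp

theorem isExpansion.tail {m : ℕ} {q x : ℝ} (hq : 1 < q) {c : ℕ → ℕ} (h : isExpansion m q x c) :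
    isExpansion m q (q * x - c 0) fun i => c (i + 1) := by
  refine ⟨fun i => h.1 _, ?_⟩
  rw [h.2, tsum_digits_eq hq h.1]
  ring

theorem isExpansion.cons {m : ℕ} {q x : ℝ} (hq : 1 < q) {d : ℕ} (hd : d ≤ m) {c : ℕ → ℕ}
    (h : isExpansion m q (q * x - d) c) : isExpansion m q x (consDigit d c) := by
  have hb : ∀ i, consDigit d c i ≤ m := by
    rintro (_ | i)
    exacts [hd, h.1 i]
  refine ⟨hb, ?_⟩
  have e : q * ∑' i : ℕ, (consDigit d c i : ℝ) / q ^ (i + 1) =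
      d + ∑' i : ℕ, (c i : ℝ) / q ^ (i + 1) := tsum_digits_eq hq hb
  rw [← h.2] at e
  exact mul_left_cancel₀ (show q ≠ 0 by linarith) (by rw [e]; ring)

theorem consDigit_head_tail (c : ℕ → ℕ) : consDigit (c 0) (fun i => c (i + 1)) = c := by
  funext i
  cases i <;> rfl

theorem consDigit_right_injective {d : ℕ} {c e : ℕ → ℕ} (h : consDigit d c = consDigit d e) :
    c = e :=
  funext fun i => congrFun h (i + 1)

/-- The greedy choice of digit keeps the remainder in `I_q`. -/
theorem greedy_step {m : ℕ} {q x : ℝ} (hq : q ∈ Set.Ioc 1 ((m : ℝ) + 1))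
    (hx : x ∈ Set.Icc 0 ((m : ℝ) / (q - 1))) :
    q * x - (min m ⌊q * x⌋₊ : ℕ) ∈ Set.Icc 0 ((m : ℝ) / (q - 1)) := by
  obtain ⟨hq1, hqm⟩ := hq
  have hL : 1 ≤ (m : ℝ) / (q - 1) := by
    rw [le_div_iff₀ (by linarith)]
    linarith
  have hqL : q * ((m : ℝ) / (q - 1)) = (m : ℝ) / (q - 1) + m := by
    have : q - 1 ≠ 0 := by linarith
    field_simp
    ring
  have hqx : 0 ≤ q * x := mul_nonneg (by linarith) hx.1
  have hfl := Nat.floor_le hqx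
  have hfl' := Nat.lt_floor_add_one (q * x)
  rcases le_total m ⌊q * x⌋₊ with h | h
  · have h' : (m : ℝ) ≤ ⌊q * x⌋₊ := by exact_mod_cast h
    have := mul_le_mul_of_nonneg_left hx.2 (show 0 ≤ q by linarith)
    rw [min_eq_left h]
    constructor <;> linarith
  · rw [min_eq_right h]
    constructor <;> linarith

/-- Every point of `I_q` has a `q`-expansion when `q ≤ m + 1`. -/
theorem exists_isExpansion {m : ℕ} {q x : ℝ} (hq : q ∈ Set.Ioc 1 ((m : ℝ) + 1))
    (hx : x ∈ Set.Icc 0 ((m : ℝ) / (q - 1))) : ∃ c, isExpansion m q x c := by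
  have hq0 : 0 < q := by linarith [hq.1]
  let T : ℝ → ℝ := fun t => q * t - (min m ⌊q * t⌋₊ : ℕ)
  let c : ℕ → ℕ := fun n => min m ⌊q * T^[n] x⌋₊
  have hT : ∀ n, T^[n] x ∈ Set.Icc 0 ((m : ℝ) / (q - 1)) := by
    intro n
    induction n with
    | zero => exact hx
    | succ n ih =>
      rw [Function.iterate_succ_apply']
      exact greedy_step hq ih
  have hsum : ∀ n, ∑ i ∈ Finset.range n, (c i : ℝ) / q ^ (i + 1) = x - T^[n] x * (q ^ n)⁻¹ := by
    intro n
    induction n with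
    | zero => simp
    | succ n ih =>
      have hs : T^[n + 1] x = q * T^[n] x - c n := by
        rw [Function.iterate_succ_apply']
      rw [Finset.sum_range_succ, ih, hs, pow_succ]
      field_simp
      ring
  have hc : ∀ i, c i ≤ m := fun i => min_le_left _ _
  refine ⟨c, hc, ?_⟩
  have hz : Filter.Tendsto (fun n : ℕ => T^[n] x * (q ^ n)⁻¹) Filter.atTop (nhds 0) := by
    have hinv : Filter.Tendsto (fun n : ℕ => (m : ℝ) / (q - 1) * (q ^ n)⁻¹)
        Filter.atTop (nhds 0) := by
      simpa using (tendsto_inv_atTop_zero.comp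
        (tendsto_pow_atTop_atTop_of_one_lt hq.1)).const_mul ((m : ℝ) / (q - 1))
    refine squeeze_zero (fun n => mul_nonneg (hT n).1 (by positivity)) (fun n => ?_) hinv
    exact mul_le_mul_of_nonneg_right (hT n).2 (by positivity)
  have h1 := (summable_digits hq.1 hc).hasSum.tendsto_sum_nat
  simp only [hsum] at h1
  refine tendsto_nhds_unique ?_ h1
  simpa using (tendsto_const_nhds (x := x)).sub hz

theorem Uq_step {m : ℕ} {q t : ℝ} (hq : q ∈ Set.Ioc 1 ((m : ℝ) + 1)) (ht : t ∈ Uq m q) {d : ℕ}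
    (hd : d ≤ m) (h : q * t - d ∈ Set.Icc 0 ((m : ℝ) / (q - 1))) : q * t - d ∈ Uq m q := by
  obtain ⟨c, hc⟩ := exists_isExpansion hq h
  exact ⟨h, c, hc, fun e he =>
    consDigit_right_injective (ht.2.unique (he.cons hq.1 hd) (hc.cons hq.1 hd))⟩

theorem Uq_digit_unique {m : ℕ} {q t : ℝ} (hq : q ∈ Set.Ioc 1 ((m : ℝ) + 1)) (ht : t ∈ Uq m q)
    {d e : ℕ} (hd : d ≤ m) (he : e ≤ m) (h : q * t - d ∈ Set.Icc 0 ((m : ℝ) / (q - 1)))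
    (h' : q * t - e ∈ Set.Icc 0 ((m : ℝ) / (q - 1))) : d = e := by
  obtain ⟨c, hc⟩ := exists_isExpansion hq h
  obtain ⟨c', hc'⟩ := exists_isExpansion hq h'
  exact congrFun (ht.2.unique (hc.cons hq.1 hd) (hc'.cons hq.1 he)) 0

theorem Uq_near_endpoint {m : ℕ} (hm : 0 < m) {q t : ℝ} (hq : q ∈ Set.Ioc 1 ((m : ℝ) + 1))
    (hL : 2 ≤ (m : ℝ) / (q - 1)) (ht : t ∈ Uq m q) :
    q * t < 1 ∨ (m : ℝ) / (q - 1) + m - 1 < q * t := by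
  by_contra! h
  obtain ⟨h1, h2⟩ := h
  set L := (m : ℝ) / (q - 1)
  set d := ⌈q * t - L⌉₊ with hd
  have hdm : d ≤ m - 1 := by
    rw [hd, Nat.ceil_le, Nat.cast_sub hm, Nat.cast_one]
    linarith
  have hle : q * t - L ≤ d := Nat.le_ceil _
  have hge : (d : ℝ) + 1 ≤ q * t := by
    rcases le_total (q * t - L) 0 with h0 | h0
    · rw [hd, Nat.ceil_eq_zero.2 h0]
      simpa using h1
    · have := Nat.ceil_lt_add_one h0
      linarith
  have key := Uq_digit_unique hq ht (d := d) (e := d + 1) (by omega) (by omega)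
    ⟨by linarith, by linarith⟩ ⟨by push_cast; linarith, by push_cast; linarith⟩
  omega

theorem eq_zero_of_forall_pow_mul_le {q t B : ℝ} (hq : 1 < q) (ht : 0 ≤ t)
    (h : ∀ n : ℕ, q ^ n * t ≤ B) : t = 0 := by
  by_contra hne
  have hpos : 0 < t := lt_of_le_of_ne ht (Ne.symm hne)
  obtain ⟨n, hn⟩ := pow_unbounded_of_one_lt (B / t) hq
  have := (div_lt_iff₀ hpos).1 hn
  linarith [h n]

/-- If `I_q` has length at least `2`, only its endpoints have a unique expansion. -/
theorem Uq_eq_endpoint {m : ℕ} (hm : 0 < m) {q t : ℝ} (hq : q ∈ Set.Ioc 1 ((m : ℝ) + 1))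
    (hL : 2 ≤ (m : ℝ) / (q - 1)) (ht : t ∈ Uq m q) : t = 0 ∨ t = (m : ℝ) / (q - 1) := by
  have near := fun {s : ℝ} (hs : s ∈ Uq m q) => Uq_near_endpoint hm hq hL hs
  have step := fun {s : ℝ} (hs : s ∈ Uq m q) (d : ℕ) (hd : d ≤ m) => Uq_step hq hs hd
  have hqL : q * ((m : ℝ) / (q - 1)) = (m : ℝ) / (q - 1) + m := by
    have : q - 1 ≠ 0 := by linarith [hq.1]
    field_simp
    ring
  set L := (m : ℝ) / (q - 1)
  obtain ⟨hq1, hqm⟩ := hq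
  have hq0 : 0 < q := by linarith
  rcases near ht with h | h
  · left
    have key : ∀ n : ℕ, q ^ n * t ∈ Uq m q ∧ q * (q ^ n * t) < 1 := by
      intro n
      induction n with
      | zero => simpa using ⟨ht, h⟩
      | succ n ih =>
        obtain ⟨hU, hlt⟩ := ih
        have hnn := mul_nonneg hq0.le hU.1.1
        have hs := step hU 0 (Nat.zero_le _) ⟨by simpa using hnn, by push_cast; linarith⟩
        have e : q * (q ^ n * t) - (0 : ℕ) = q ^ (n + 1) * t := by
          push_cast
          ring
        rw [e] at hs
        refine ⟨hs, (near hs).resolve_right ?_⟩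
        have : q ^ (n + 1) * t < 1 := by
          rw [← e]
          simpa using hlt
        nlinarith
    exact eq_zero_of_forall_pow_mul_le hq1 ht.1.1 fun n => (key n).1.1.2
  · right
    have key : ∀ n : ℕ, L - q ^ n * (L - t) ∈ Uq m q ∧
        L + m - 1 < q * (L - q ^ n * (L - t)) := by
      intro n
      induction n with
      | zero => simpa using ⟨ht, h⟩
      | succ n ih =>
        obtain ⟨hU, hlt⟩ := ih
        have hle := mul_le_mul_of_nonneg_left hU.1.2 hq0.le
        have hs := step hU m le_rfl ⟨by linarith, by linarith⟩
        have e : q * (L - q ^ n * (L - t)) - m = L - q ^ (n + 1) * (L - t) := by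
          rw [mul_sub, hqL]
          ring
        rw [e] at hs
        refine ⟨hs, (near hs).resolve_left ?_⟩
        have : L - 1 < L - q ^ (n + 1) * (L - t) := by linarith
        nlinarith
    have := eq_zero_of_forall_pow_mul_le (t := L - t) (B := L) hq1 (by linarith [ht.1.2])
      fun n => by linarith [(key n).1.1.1]
    linarith

theorem exists_sub_eq_one_of_head_lt {m : ℕ} {q x : ℝ} (hq : q ∈ Set.Ioc 1 ((m : ℝ) + 1))
    {a b : ℕ → ℕ} (hlt : a 0 < b 0) (ha : isExpansion m q x a) (hb : isExpansion m q x b)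
    (hc : ∀ c, isExpansion m q x c → c = a ∨ c = b) :
    ∃ x ∈ Uq m q, ∃ y ∈ Uq m q, x - y = 1 := by
  have ta := ha.tail hq.1
  have tb := hb.tail hq.1
  have ia := isExpansion_mem_Icc hq.1 ta
  have ib := isExpansion_mem_Icc hq.1 tb
  refine ⟨_, ⟨ia, _, ta, fun e he => ?_⟩, _, ⟨ib, _, tb, fun e he => ?_⟩, ?_⟩
  · rcases hc _ (he.cons hq.1 (ha.1 0)) with h | h
    · exact funext fun i => congrFun h (i + 1)
    · exact absurd (congrFun h 0) hlt.ne
  · rcases hc _ (he.cons hq.1 (hb.1 0)) with h | h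
    · exact absurd (congrFun h 0) hlt.ne'
    · exact funext fun i => congrFun h (i + 1)
  · suffices hs : a 0 + 1 = b 0 by
      rw [← hs]
      push_cast
      ring
    have hle : ((a 0 + 1 : ℕ) : ℝ) ≤ b 0 := by exact_mod_cast hlt
    obtain ⟨e, he⟩ := exists_isExpansion (x := q * x - (a 0 + 1 : ℕ)) hq
      ⟨by linarith [ib.1], by push_cast; linarith [ia.2]⟩
    rcases hc _ (he.cons hq.1 (Nat.succ_le_of_lt (hlt.trans_le (hb.1 0)))) with h | h
    · exact absurd (congrFun h 0) (Nat.succ_ne_self _)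
    · exact congrFun h 0

theorem exists_sub_eq_one_of_two_expansions {m : ℕ} {q : ℝ} (hq : q ∈ Set.Ioc 1 ((m : ℝ) + 1))
    (n : ℕ) : ∀ (x : ℝ) (a b : ℕ → ℕ), a n ≠ b n → isExpansion m q x a → isExpansion m q x b →
      (∀ c, isExpansion m q x c → c = a ∨ c = b) →
      ∃ x ∈ Uq m q, ∃ y ∈ Uq m q, x - y = 1 := by
  induction n with
  | zero =>
    intro x a b hne ha hb hc
    rcases lt_or_gt_of_ne hne with h | h
    · exact exists_sub_eq_one_of_head_lt hq h ha hb hc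
    · exact exists_sub_eq_one_of_head_lt hq h hb ha fun c h' => (hc c h').symm
  | succ n ih =>
    intro x a b hne ha hb hc
    rcases lt_trichotomy (a 0) (b 0) with h | h | h
    · exact exists_sub_eq_one_of_head_lt hq h ha hb hc
    · have tb := hb.tail hq.1
      rw [← h] at tb
      refine ih _ _ _ hne (ha.tail hq.1) tb fun c hexp => ?_
      exact (hc _ (hexp.cons hq.1 (ha.1 0))).imp
        (fun e => funext fun i => congrFun e (i + 1))
        (fun e => funext fun i => congrFun e (i + 1))
    · exact exists_sub_eq_one_of_head_lt hq h hb ha fun c h' => (hc c h').symm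

/-- `q ∈ B_2(m)` iff `1 ∈ U_q - U_q`. -/
theorem stmt2 (m : ℕ) (hm : 0 < m) (q : ℝ) (hq : q ∈ Set.Ioc 1 ((m : ℝ) + 1)) :
    q ∈ B2 m ↔ ∃ x ∈ Uq m q, ∃ y ∈ Uq m q, x - y = 1 := by
  constructor
  · rintro ⟨-, x, -, a, b, hne, ha, hb, hc⟩
    obtain ⟨n, hn⟩ := Function.ne_iff.1 hne
    exact exists_sub_eq_one_of_two_expansions hq n x a b hn ha hb hc
  · rintro ⟨x, hx, y, hy, hxy⟩
    have hL : (m : ℝ) / (q - 1) < 2 := by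
      by_contra! hL
      rcases Uq_eq_endpoint hm hq hL hx with h | h <;>
        rcases Uq_eq_endpoint hm hq hL hy with h' | h' <;> linarith
    have hq0 : q ≠ 0 := by linarith [hq.1]
    have hqx : q * (x / q) = x := mul_div_cancel₀ x hq0
    obtain ⟨a, ha, hua⟩ := hx.2
    obtain ⟨b, hb, hub⟩ := hy.2
    have ea : isExpansion m q (x / q) (consDigit 0 a) :=
      isExpansion.cons hq.1 (Nat.zero_le m) (by simpa [hqx] using ha)
    have eb : isExpansion m q (x / q) (consDigit 1 b) := by
      refine isExpansion.cons hq.1 hm ?_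
      rwa [hqx, Nat.cast_one, show x - 1 = y by linarith]
    refine ⟨hq, x / q, isExpansion_mem_Icc hq.1 ea, _, _,
      fun h => absurd (congrFun h 0) zero_ne_one, ea, eb, fun c hc => ?_⟩
    have tc := hc.tail hq.1
    have hnn := (isExpansion_mem_Icc hq.1 tc).1
    rw [hqx] at tc hnn
    have hc0 : c 0 < 2 := by
      have : (c 0 : ℝ) < 2 := by linarith [hx.1.2]
      exact_mod_cast this
    rw [← consDigit_head_tail c]
    obtain h | h : c 0 = 0 ∨ c 0 = 1 := by omega
    · left
      rw [h, Nat.cast_zero, sub_zero] at tc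
      rw [h, hua _ tc]
    · right
      rw [h, Nat.cast_one, show x - 1 = y by linarith] at tc
      rw [h, hub _ tc]
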